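/- arXiv:1809.03059 — 3 statements merged into one kernel-verified Lean document; each statement's English description precedes it below -/
import Mathlib

section
/- The join in P^N of the Veronese varieties ν_{b_1}(P^{α_1}), ..., ν_{b_n}(P^{α_n}), embedded in pairwise complementary linear subspaces, has degree Π_{i=1}^n b_i^{α_i} and dimension Σ α_i + n − 1. -/
open MvPolynomial

noncomputable section

def coxWeight (n : ℕ) (a : Fin n → ℕ) : ((i : Fin n) × Fin (a i + 1)) → (Fin n → ℕ) :=
  fun p => Pi.single p.1 1

def quotComponent {k : Type} [Field k] {n : ℕ} {a : Fin n → ℕ}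
    (I : Ideal (MvPolynomial ((i : Fin n) × Fin (a i + 1)) k)) (d : Fin n → ℕ) :
    Submodule k (MvPolynomial ((i : Fin n) × Fin (a i + 1)) k ⧸ I) :=
  (weightedHomogeneousSubmodule k (coxWeight n a) d).map
    (Ideal.Quotient.mkₐ k I).toLinearMap

/-- The Hilbert function of the standard graded ring `T_b(A/I)`, the homogeneous
coordinate ring of `C(Z;b)`. -/
def hilbTb {k : Type} [Field k] {n : ℕ} {a : Fin n → ℕ}
    (I : Ideal (MvPolynomial ((i : Fin n) × Fin (a i + 1)) k)) (b : Fin n → ℕ)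
    (s : ℕ) : ℕ :=
  Module.finrank k
    ↥(⨆ t ∈ Finset.Nat.antidiagonalTuple n s, quotComponent I (fun i => b i * t i))

/-- `h` is eventually given by a polynomial of degree `D` whose leading coefficient,
normalized by `D!`, is `e`; i.e. the corresponding projective scheme has dimension
`D` and degree `e`. -/
def HasDegreeDim (h : ℕ → ℕ) (D : ℕ) (e : ℚ) : Prop :=
  ∃ P : Polynomial ℚ, (∃ s₀, ∀ s ≥ s₀, (h s : ℚ) = P.eval (s : ℚ)) ∧
    P.natDegree = D ∧ P.leadingCoeff * (Nat.factorial D) = e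

theorem card_weight_eq {n : ℕ} (α : Fin n → ℕ) (d : Fin n → ℕ) :
    Nat.card {m : ((i : Fin n) × Fin (α i + 1)) →₀ ℕ // Finsupp.weight (coxWeight n α) m = d}
      = ∏ i, (α i + d i).choose (α i) := by
  have e : {m : ((i : Fin n) × Fin (α i + 1)) →₀ ℕ // Finsupp.weight (coxWeight n α) m = d} ≃
      ((i : Fin n) → {P : Fin (α i + 1) → ℕ // ∑ j, P j = d i}) := by
    refine (Equiv.subtypeEquiv
      (Finsupp.equivFunOnFinite.trans (Equiv.piCurry (fun (i : Fin n) (_ : Fin (α i + 1)) => ℕ)))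
      (q := fun f => ∀ i, ∑ j, f i j = d i) ?_).trans
      (Equiv.subtypePiEquivPi (p := fun i (P : Fin (α i + 1) → ℕ) => ∑ j, P j = d i))
    intro m
    rw [funext_iff]
    refine forall_congr' fun i => ?_
    have : Finsupp.weight (coxWeight n α) m i = ∑ j, m ⟨i, j⟩ := by
      rw [Finsupp.weight_apply, Finsupp.sum_fintype _ _ (by simp), Fintype.sum_sigma,
        Finset.sum_apply, Finset.sum_eq_single i]
      · simp [coxWeight]
      · intro j _ hj
        simp [coxWeight, hj.symm]
      · simp
    rw [this]
    rfl
  rw [Nat.card_congr e, Nat.card_pi]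
  refine Finset.prod_congr rfl fun i _ => ?_
  rw [← Nat.card_congr (Sym.equivNatSumOfFintype (Fin (α i + 1)) (d i)), Nat.card_eq_fintype_card,
    Sym.card_sym_eq_choose]
  simp only [Fintype.card_fin]
  rw [show α i + 1 + d i - 1 = α i + d i by omega]
  exact (Nat.choose_symm_add).symm

theorem hilb_eq {k : Type} [Field k] {n : ℕ}
    (α : Fin n → ℕ) (b : Fin n → ℕ) (hb : ∀ i, 0 < b i) (s : ℕ) :
    hilbTb (a := α) (⊥ : Ideal (MvPolynomial ((i : Fin n) × Fin (α i + 1)) k)) b s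
      = ∑ t ∈ Finset.Nat.antidiagonalTuple n s, ∏ i, (α i + b i * t i).choose (α i) := by
  have hinj : Function.Injective (Ideal.Quotient.mkₐ k
      (⊥ : Ideal (MvPolynomial ((i : Fin n) × Fin (α i + 1)) k))).toLinearMap := by
    intro x y h
    have h' := Ideal.Quotient.eq.1 (show Ideal.Quotient.mk _ x = Ideal.Quotient.mk _ y from h)
    exact sub_eq_zero.1 (by simpa using h')
  have hsup : (⨆ t ∈ Finset.Nat.antidiagonalTuple n s,
      weightedHomogeneousSubmodule k (coxWeight n α) (fun i => b i * t i)) =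
      restrictSupport k {m | ∃ t ∈ Finset.Nat.antidiagonalTuple n s,
        Finsupp.weight (coxWeight n α) m = fun i => b i * t i} := by
    apply le_antisymm
    · refine iSup₂_le fun t ht => ?_
      rw [weightedHomogeneousSubmodule_eq_finsupp_supported]
      exact restrictSupport_mono (R := k) fun m hm => ⟨t, ht, hm⟩
    · rw [restrictSupport_eq_span, Submodule.span_le]
      rintro _ ⟨m, ⟨t, ht, hm⟩, rfl⟩
      exact Submodule.mem_iSup_of_mem t (Submodule.mem_iSup_of_mem ht
        ((mem_weightedHomogeneousSubmodule _ _ _ _).2 (isWeightedHomogeneous_monomial _ _ _ hm)))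
  unfold hilbTb quotComponent
  have hmap : (⨆ t ∈ Finset.Nat.antidiagonalTuple n s,
      (weightedHomogeneousSubmodule k (coxWeight n α) (fun i => b i * t i)).map
        (Ideal.Quotient.mkₐ k
          (⊥ : Ideal (MvPolynomial ((i : Fin n) × Fin (α i + 1)) k))).toLinearMap) =
      (⨆ t ∈ Finset.Nat.antidiagonalTuple n s,
      weightedHomogeneousSubmodule k (coxWeight n α) (fun i => b i * t i)).map
        (Ideal.Quotient.mkₐ k
          (⊥ : Ideal (MvPolynomial ((i : Fin n) × Fin (α i + 1)) k))).toLinearMap := by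
    simp only [Submodule.map_iSup]
  rw [hmap, ← LinearEquiv.finrank_eq (Submodule.equivMapOfInjective _ hinj _), hsup,
    Module.finrank_eq_nat_card_basis (basisRestrictSupport k _)]
  let f : (Σ t : Finset.Nat.antidiagonalTuple n s,
      {m : ((i : Fin n) × Fin (α i + 1)) →₀ ℕ //
        Finsupp.weight (coxWeight n α) m = fun i => b i * t.1 i}) →
      {m : ((i : Fin n) × Fin (α i + 1)) →₀ ℕ | ∃ t ∈ Finset.Nat.antidiagonalTuple n s,
        Finsupp.weight (coxWeight n α) m = fun i => b i * t i} :=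
    fun x => ⟨x.2.1, x.1.1, x.1.2, x.2.2⟩
  have hf : Function.Bijective f := by
    constructor
    · rintro ⟨⟨t, ht⟩, ⟨m, hm⟩⟩ ⟨⟨t', ht'⟩, ⟨m', hm'⟩⟩ h
      have h1 : m = m' := congrArg Subtype.val h
      subst h1
      have h2 : t = t' := by
        funext i
        have := congrFun (hm.symm.trans hm') i
        exact Nat.eq_of_mul_eq_mul_left (hb i) this
      subst h2
      rfl
    · rintro ⟨m, t, ht, hm⟩
      exact ⟨⟨⟨t, ht⟩, ⟨m, hm⟩⟩, rfl⟩
  have hpos : ∀ t : Finset.Nat.antidiagonalTuple n s,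
      Finite {m : ((i : Fin n) × Fin (α i + 1)) →₀ ℕ //
        Finsupp.weight (coxWeight n α) m = fun i => b i * t.1 i} := fun t =>
    Nat.finite_of_card_ne_zero (by
      rw [card_weight_eq]
      exact Finset.prod_ne_zero_iff.2 fun i _ => (Nat.choose_pos (Nat.le_add_right _ _)).ne')
  rw [← Nat.card_congr (Equiv.ofBijective f hf), Nat.card_sigma]
  simp only [card_weight_eq]
  exact Finset.sum_coe_sort (Finset.Nat.antidiagonalTuple n s)
    (fun t => ∏ i, (α i + b i * t i).choose (α i))

theorem coeff_prod_tuple {n : ℕ} (f : Fin n → ℕ → ℚ) (s : ℕ) :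
    PowerSeries.coeff s (∏ i, PowerSeries.mk (f i)) =
      ∑ t ∈ Finset.Nat.antidiagonalTuple n s, ∏ i, f i (t i) := by
  rw [PowerSeries.coeff_prod, ← Finset.piAntidiag_univ_fin_eq_antidiagonalTuple]
  refine Finset.sum_bij (fun l _ => l) ?_ ?_ ?_ ?_ <;> simp
  intro a ha
  exact ⟨Finsupp.equivFunOnFinite.symm a, by simpa using ha, by simp⟩

abbrev uu : PowerSeries ℚ := PowerSeries.mk 1

open Polynomial in
def binPoly (j : ℕ) : Polynomial ℚ := Polynomial.C ((Nat.factorial j : ℚ)⁻¹) * (ascPochhammer ℚ j).comp (Polynomial.X + 1)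

open Polynomial in
theorem binPoly_eval (j s : ℕ) : (binPoly j).eval (s : ℚ) = ((j + s).choose j : ℕ) := by
  have h : ((s : ℚ) + 1) = ((s + 1 : ℕ) : ℚ) := by push_cast; rfl
  have hf : (Nat.factorial j : ℚ) ≠ 0 := by positivity
  rw [binPoly, Polynomial.eval_mul, Polynomial.eval_C, eval_comp, Polynomial.eval_add,
    Polynomial.eval_X, eval_one, h, ascPochhammer_nat_eq_natCast_ascFactorial,
    Nat.ascFactorial_eq_factorial_mul_choose, Nat.cast_mul, inv_mul_cancel_left₀ hf, add_comm j s]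

open Polynomial in
theorem binPoly_natDegree (j : ℕ) : (binPoly j).natDegree = j := by
  rw [binPoly, natDegree_C_mul (by positivity), natDegree_comp]
  rw [ascPochhammer_natDegree, show (Polynomial.X + 1 : Polynomial ℚ) = Polynomial.X + Polynomial.C 1 by simp, natDegree_X_add_C]
  simp

open Polynomial in
theorem binPoly_coeff (j : ℕ) : (binPoly j).coeff j = (Nat.factorial j : ℚ)⁻¹ := by
  have h := (monic_ascPochhammer ℚ j).comp_X_add_C 1
  have h2 : ((ascPochhammer ℚ j).comp (Polynomial.X + Polynomial.C 1)).natDegree = j := by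
    rw [natDegree_comp, ascPochhammer_natDegree, natDegree_X_add_C, mul_one]
  have h3 := h.coeff_natDegree
  rw [h2] at h3
  rw [binPoly, Polynomial.coeff_C_mul, ← Polynomial.C_1, h3, mul_one]

open Polynomial in
theorem mk_binPoly (j : ℕ) : PowerSeries.mk (fun s : ℕ => (binPoly j).eval (s : ℚ)) = uu ^ (j + 1) := by
  rw [PowerSeries.mk_one_pow_eq_mk_choose_add]
  simp only [binPoly_eval]

def Good (F : PowerSeries ℚ) (m : ℕ) (e : ℚ) : Prop :=
  ∃ p : Polynomial ℚ, p.natDegree ≤ m ∧ p.coeff m = e ∧ F = Polynomial.aeval uu p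

theorem Good.mul {F G : PowerSeries ℚ} {m m' : ℕ} {e e' : ℚ} (h : Good F m e) (h' : Good G m' e') :
    Good (F * G) (m + m') (e * e') := by
  obtain ⟨p, hp, rfl, rfl⟩ := h
  obtain ⟨q, hq, rfl, rfl⟩ := h'
  exact ⟨p * q, Polynomial.natDegree_mul_le_of_le hp hq,
    Polynomial.coeff_mul_add_eq_of_natDegree_le hp hq, by simp⟩

theorem Good.prod {ι : Type} (S : Finset ι) {F : ι → PowerSeries ℚ} {m : ι → ℕ} {e : ι → ℚ}
    (h : ∀ i, Good (F i) (m i) (e i)) :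
    Good (∏ i ∈ S, F i) (∑ i ∈ S, m i) (∏ i ∈ S, e i) := by
  classical
  induction S using Finset.induction_on with
  | empty => exact ⟨1, by simp, by simp, by simp⟩
  | insert a S ha ih =>
    rw [Finset.prod_insert ha, Finset.prod_insert ha, Finset.sum_insert ha]
    exact (h a).mul ih

open Polynomial in
theorem good_poly (D : ℕ) : ∀ P : Polynomial ℚ, P.natDegree ≤ D →
    Good (PowerSeries.mk (fun s : ℕ => P.eval (s : ℚ))) (D + 1) (P.coeff D * Nat.factorial D) := by
  induction D with
  | zero =>
    intro P hP
    obtain ⟨c, rfl⟩ := natDegree_eq_zero.1 (Nat.le_zero.1 hP)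
    refine ⟨Polynomial.C _ * Polynomial.X, Polynomial.natDegree_C_mul_le _ _ |>.trans Polynomial.natDegree_X_le, by simp; rfl, ?_⟩
    ext s
    simp [PowerSeries.coeff_mk, ← PowerSeries.smul_eq_C_mul]
  | succ D ih =>
    intro P hP
    set c := P.coeff (D + 1) * Nat.factorial (D + 1) with hc
    have hQ : (P - Polynomial.C c * binPoly (D + 1)).natDegree ≤ D := by
      rw [natDegree_le_iff_coeff_eq_zero]
      intro N hN
      rw [Polynomial.coeff_sub, Polynomial.coeff_C_mul]
      rcases (Nat.succ_le_of_lt hN).eq_or_lt with rfl | h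
      · rw [Nat.succ_eq_add_one, binPoly_coeff, hc]
        field_simp
        simp
      · rw [coeff_eq_zero_of_natDegree_lt (lt_of_le_of_lt hP h),
          coeff_eq_zero_of_natDegree_lt (by rw [binPoly_natDegree]; exact h)]
        simp
    clear_value c
    obtain ⟨q, hq, -, hq'⟩ := ih _ hQ
    refine ⟨q + Polynomial.C c * Polynomial.X ^ (D + 2), ?_, ?_, ?_⟩
    · exact natDegree_add_le_of_degree_le (by omega) (natDegree_C_mul_X_pow_le _ _)
    · rw [Polynomial.coeff_add, coeff_eq_zero_of_natDegree_lt (by omega)]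
      simp
    · rw [map_add, ← hq', map_mul, map_pow, Polynomial.aeval_X, Polynomial.aeval_C, ← mk_binPoly (D + 1)]
      ext s
      simp

open Polynomial in
theorem Good.final {h : ℕ → ℕ} {D : ℕ} {e : ℚ} (he : e ≠ 0)
    (hg : Good (PowerSeries.mk fun s => (h s : ℚ)) (D + 1) e) : HasDegreeDim h D e := by
  obtain ⟨p, hp, hpe, hF⟩ := hg
  have hcoeff : (∑ j ∈ Finset.range (D + 1), Polynomial.C (p.coeff (j + 1)) * binPoly j).coeff D
      = e * (Nat.factorial D : ℚ)⁻¹ := by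
    rw [finsetSum_coeff, Finset.sum_range_succ, Finset.sum_eq_zero, zero_add, Polynomial.coeff_C_mul,
      binPoly_coeff, hpe]
    intro j hj
    rw [Polynomial.coeff_C_mul, coeff_eq_zero_of_natDegree_lt (p := binPoly j) (by rw [binPoly_natDegree]; simpa using hj),
      mul_zero]
  have hdeg : (∑ j ∈ Finset.range (D + 1), Polynomial.C (p.coeff (j + 1)) * binPoly j).natDegree = D := by
    apply le_antisymm
    · apply natDegree_sum_le_of_forall_le
      intro j hj
      refine (natDegree_C_mul_le _ _).trans ?_
      rw [binPoly_natDegree]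
      have := Finset.mem_range.1 hj
      omega
    · apply le_natDegree_of_ne_zero
      rw [hcoeff]
      positivity
  refine ⟨∑ j ∈ Finset.range (D + 1), Polynomial.C (p.coeff (j + 1)) * binPoly j, ⟨1, ?_⟩, hdeg, ?_⟩
  · intro s hs
    have h1 := congrArg (PowerSeries.coeff s) hF
    rw [PowerSeries.coeff_mk, aeval_eq_sum_range' (Nat.lt_succ_of_le hp), Finset.sum_range_succ',
      map_add, map_sum] at h1
    rw [h1, eval_finsetSum]
    simp only [← mk_binPoly]
    simp [PowerSeries.coeff_one, show s ≠ 0 by omega]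
  · rw [leadingCoeff, hdeg, hcoeff]
    field_simp

theorem degree_dim_join_of_veroneses {k : Type} [Field k] {n : ℕ} (hn : 0 < n)
    (α : Fin n → ℕ) (b : Fin n → ℕ) (hb : ∀ i, 0 < b i) :
    HasDegreeDim
      (hilbTb (a := α) (⊥ : Ideal (MvPolynomial ((i : Fin n) × Fin (α i + 1)) k)) b)
      ((∑ i, α i) + n - 1)
      (∏ i, (b i : ℚ) ^ (α i)) := by
  apply Good.final
  · exact Finset.prod_ne_zero_iff.2 fun i _ => pow_ne_zero _ (by exact_mod_cast (hb i).ne')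
  have key : ∀ i, Good (PowerSeries.mk fun t : ℕ => (((α i + b i * t).choose (α i) : ℕ) : ℚ))
      (α i + 1) ((b i : ℚ) ^ α i) := by
    intro i
    have h := good_poly (α i) ((binPoly (α i)).comp (Polynomial.C (b i : ℚ) * Polynomial.X)) (by
      refine Polynomial.natDegree_comp_le.trans ?_
      rw [binPoly_natDegree]
      calc _ ≤ α i * 1 := Nat.mul_le_mul_left _ (((Polynomial.natDegree_C_mul_le _ _).trans Polynomial.natDegree_X_le))
        _ = _ := mul_one _)
    rw [Polynomial.comp_C_mul_X_coeff, binPoly_coeff] at h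
    convert h using 1
    · ext t
      simp only [PowerSeries.coeff_mk, Polynomial.eval_comp, Polynomial.eval_mul,
        Polynomial.eval_C, Polynomial.eval_X]
      rw [← Nat.cast_mul, binPoly_eval]
    · field_simp
  have h := Good.prod Finset.univ key
  convert h using 1
  · ext s
    rw [coeff_prod_tuple, PowerSeries.coeff_mk, hilb_eq α b hb]
    push_cast
    rfl
  · rw [Finset.sum_add_distrib]
    simp
    omega

end
end

section
/- The correspondence scroll C(Δ;b) of the small diagonal Δ ⊆ (P^a)^n has degree Σ_α Π_{i=1}^n b_i^{α_i}, where the sum runs over all α ∈ ℕ^n with 0 ≤ α_i ≤ a and Σ α_i = a; its dimension is a + n − 1. -/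
open MvPolynomial

noncomputable section

/-!
STATEMENT 13: the correspondence scroll `C(Δ;b)` of the small diagonal
`Δ ⊆ (ℙ^a)ⁿ` has degree `∑_{α : ∑αᵢ = a} ∏ᵢ bᵢ^{αᵢ}` and dimension `a + n − 1`.
-/

/-- The ideal of the small diagonal `Δ ⊆ (ℙ^a)ⁿ`: the 2×2 minors of the generic
`(a+1) × n` matrix. -/
def smallDiagonalIdeal (k : Type) [Field k] (n a : ℕ) :
    Ideal (MvPolynomial ((i : Fin n) × Fin (a + 1)) k) :=
  Ideal.span { f | ∃ (p q : Fin n) (j l : Fin (a + 1)),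
    f = X ⟨p, j⟩ * X ⟨q, l⟩ - X ⟨p, l⟩ * X ⟨q, j⟩ }


section margins
variable {n m : ℕ}

def rowSum (M : ((_ : Fin n) × Fin m) →₀ ℕ) : Fin n → ℕ := fun i => ∑ j, M ⟨i, j⟩
def colSum (M : ((_ : Fin n) × Fin m) →₀ ℕ) : Fin m → ℕ := fun j => ∑ i, M ⟨i, j⟩

lemma rowSum_add (M N : ((_ : Fin n) × Fin m) →₀ ℕ) :
    rowSum (M + N) = rowSum M + rowSum N := by
  funext i; simp [rowSum, Finset.sum_add_distrib]

lemma colSum_add (M N : ((_ : Fin n) × Fin m) →₀ ℕ) :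
    colSum (M + N) = colSum M + colSum N := by
  funext i; simp [colSum, Finset.sum_add_distrib]

lemma rowSum_single (p : Fin n) (j : Fin m) :
    rowSum (Finsupp.single (⟨p, j⟩ : (_ : Fin n) × Fin m) 1) = Pi.single p 1 := by
  funext i
  by_cases h : i = p
  · subst h; simp [rowSum, Finsupp.single_apply]
  · have : ¬ p = i := fun h' => h h'.symm
    simp [rowSum, Finsupp.single_apply, h, this]

lemma colSum_single (p : Fin n) (j : Fin m) :
    colSum (Finsupp.single (⟨p, j⟩ : (_ : Fin n) × Fin m) 1) = Pi.single j 1 := by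
  funext i
  by_cases h : i = j
  · subst h; simp [colSum, Finsupp.single_apply]
  · have : ¬ j = i := fun h' => h h'.symm
    simp [colSum, Finsupp.single_apply, h, this]

lemma sum_rowSum (M : ((_ : Fin n) × Fin m) →₀ ℕ) : ∑ i, rowSum M i = ∑ j, colSum M j := by
  unfold rowSum colSum
  exact Finset.sum_comm

lemma exists_sub_single {ι : Type*} [DecidableEq ι] (d : ι → ℕ) (i : ι) (h : 0 < d i) :
    ∃ d' : ι → ℕ, d = d' + Pi.single i 1 := by
  refine ⟨d - Pi.single i 1, ?_⟩
  funext x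
  by_cases hx : x = i
  · subst hx; simp; omega
  · simp [hx]

lemma exists_sub_finsupp {ι : Type*} (M : ι →₀ ℕ) (i : ι) (h : 0 < M i) :
    ∃ M', M = M' + Finsupp.single i 1 :=
  ⟨M - Finsupp.single i 1, (tsub_add_cancel_of_le (by simpa using Nat.succ_le_of_lt h)).symm⟩

lemma exists_margins (N : ℕ) (d : Fin n → ℕ) (e : Fin m → ℕ) (hd : ∑ i, d i = N)
    (he : ∑ j, e j = N) :
    ∃ M : ((_ : Fin n) × Fin m) →₀ ℕ, rowSum M = d ∧ colSum M = e := by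
  induction N generalizing d e with
  | zero =>
    refine ⟨0, ?_, ?_⟩
    · funext i
      rw [Finset.sum_eq_zero_iff] at hd
      simp [rowSum, hd i]
    · funext i
      rw [Finset.sum_eq_zero_iff] at he
      simp [colSum, he i]
  | succ N ih =>
    obtain ⟨i, -, hi⟩ : ∃ i ∈ Finset.univ, 0 < d i :=
      Finset.sum_pos_iff.mp (by omega)
    obtain ⟨j, -, hj⟩ : ∃ i ∈ Finset.univ, 0 < e i :=
      Finset.sum_pos_iff.mp (by omega)
    obtain ⟨d, rfl⟩ := exists_sub_single d i hi
    obtain ⟨e, rfl⟩ := exists_sub_single e j hj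
    obtain ⟨M, h1, h2⟩ := ih d e (by simpa [Finset.sum_add_distrib] using hd)
      (by simpa [Finset.sum_add_distrib] using he)
    exact ⟨M + Finsupp.single ⟨i, j⟩ 1, by rw [rowSum_add, rowSum_single, h1],
      by rw [colSum_add, colSum_single, h2]⟩

end margins

section algebra
variable (k : Type) [Field k] (n a : ℕ)

abbrev SD := MvPolynomial ((_ : Fin n) × Fin (a + 1)) k ⧸ smallDiagonalIdeal k n a

/-- class of a monomial -/
def mon (M : ((_ : Fin n) × Fin (a + 1)) →₀ ℕ) : SD k n a :=
  Ideal.Quotient.mk (smallDiagonalIdeal k n a) (monomial M 1)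

variable {k n a}

lemma mon_add (M N : ((_ : Fin n) × Fin (a + 1)) →₀ ℕ) :
    mon k n a (M + N) = mon k n a M * mon k n a N := by
  unfold mon
  rw [← map_mul, monomial_mul, one_mul]

lemma mon_swap (p q : Fin n) (j l : Fin (a + 1)) :
    mon k n a (Finsupp.single ⟨p, l⟩ 1 + Finsupp.single ⟨q, j⟩ 1) =
      mon k n a (Finsupp.single ⟨q, l⟩ 1 + Finsupp.single ⟨p, j⟩ 1) := by
  unfold mon
  rw [Ideal.Quotient.eq]
  refine Ideal.subset_span ⟨p, q, l, j, ?_⟩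
  simp only [X, monomial_mul, one_mul]
  rw [add_comm (Finsupp.single (⟨q, l⟩ : (_ : Fin n) × Fin (a + 1)) 1)]

lemma mon_eq (N : ℕ) (M M' : ((_ : Fin n) × Fin (a + 1)) →₀ ℕ) (hN : ∑ i, rowSum M i = N)
    (hr : rowSum M = rowSum M') (hc : colSum M = colSum M') : mon k n a M = mon k n a M' := by
  induction N generalizing M M' with
  | zero =>
    have key : ∀ L : ((_ : Fin n) × Fin (a + 1)) →₀ ℕ, ∑ i, rowSum L i = 0 → L = 0 := by
      intro L hL
      ext ⟨i, j⟩
      simp only [rowSum, Finset.sum_eq_zero_iff] at hL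
      exact hL i (by simp) j (by simp)
    rw [key M hN, key M' (by rw [← hr]; exact hN)]
  | succ N ih =>
    obtain ⟨p, -, hp⟩ : ∃ i ∈ Finset.univ, 0 < rowSum M i :=
      Finset.sum_pos_iff.mp (by omega)
    obtain ⟨j, -, hj⟩ : ∃ j ∈ Finset.univ, 0 < M ⟨p, j⟩ :=
      Finset.sum_pos_iff.mp hp
    obtain ⟨M₁, rfl⟩ := exists_sub_finsupp M ⟨p, j⟩ hj
    obtain ⟨M₂, e1, e2, e3⟩ : ∃ M₂ : ((_ : Fin n) × Fin (a + 1)) →₀ ℕ,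
        mon k n a M' = mon k n a (M₂ + Finsupp.single ⟨p, j⟩ 1) ∧
        rowSum M' = rowSum (M₂ + Finsupp.single ⟨p, j⟩ 1) ∧
        colSum M' = colSum (M₂ + Finsupp.single ⟨p, j⟩ 1) := by
      by_cases h0 : 0 < M' ⟨p, j⟩
      · obtain ⟨M₂, rfl⟩ := exists_sub_finsupp M' ⟨p, j⟩ h0
        exact ⟨M₂, rfl, rfl, rfl⟩
      · have h1 : 0 < rowSum M' p := by rw [← hr]; exact hp
        have h2 : 0 < colSum M' j := by
          rw [← hc, colSum_add, colSum_single]; simp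
        obtain ⟨l, -, hl⟩ : ∃ l ∈ Finset.univ, 0 < M' ⟨p, l⟩ := Finset.sum_pos_iff.mp h1
        obtain ⟨q, -, hq⟩ : ∃ q ∈ Finset.univ, 0 < M' ⟨q, j⟩ := Finset.sum_pos_iff.mp h2
        have hlj : l ≠ j := by rintro rfl; exact h0 hl
        obtain ⟨M₃, rfl⟩ := exists_sub_finsupp M' ⟨p, l⟩ hl
        have hq' : 0 < M₃ ⟨q, j⟩ := by
          simpa [Finsupp.single_apply, hlj] using hq
        obtain ⟨M₄, rfl⟩ := exists_sub_finsupp M₃ ⟨q, j⟩ hq'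
        refine ⟨M₄ + Finsupp.single ⟨q, l⟩ 1, ?_, ?_, ?_⟩
        · rw [add_assoc, add_assoc, mon_add, mon_add M₄,
            add_comm (Finsupp.single (⟨q, j⟩ : (_ : Fin n) × Fin (a + 1)) 1), mon_swap]
        · simp only [rowSum_add, rowSum_single]
        · simp only [colSum_add, colSum_single]; abel
    rw [e1, mon_add, mon_add M₂]
    rw [e2, rowSum_add, rowSum_add M₂] at hr
    rw [e3, colSum_add, colSum_add M₂] at hc
    rw [ih M₁ M₂ ?_ (add_right_cancel hr) (add_right_cancel hc)]
    simpa [rowSum_add, rowSum_single, Finset.sum_add_distrib] using hN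

/-- exponent with given margins -/
def marg (d : Fin n → ℕ) (e : Fin (a + 1) → ℕ) : (Fin n ⊕ Fin (a + 1)) →₀ ℕ :=
  Finsupp.equivFunOnFinite.symm (Sum.elim d e)

variable (k n a) in
/-- the Segre-type map -/
def segre : MvPolynomial ((_ : Fin n) × Fin (a + 1)) k →ₐ[k]
    MvPolynomial (Fin n ⊕ Fin (a + 1)) k :=
  aeval fun p => X (Sum.inl p.1) * X (Sum.inr p.2)

lemma segre_monomial (M : ((_ : Fin n) × Fin (a + 1)) →₀ ℕ) :
    segre k n a (monomial M 1) = monomial (marg (rowSum M) (colSum M)) 1 := by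
  unfold segre
  rw [aeval_monomial, monomial_eq, Finsupp.prod_fintype _ _ (by simp),
    Finsupp.prod_fintype _ _ (by simp), Fintype.prod_sum_type]
  simp only [marg, Finsupp.equivFunOnFinite_symm_apply_apply, Sum.elim_inl, Sum.elim_inr, map_one,
    one_mul, mul_pow, Finset.prod_mul_distrib, rowSum, colSum, ← Finset.prod_pow_eq_pow_sum]
  rw [← Finset.univ_sigma_univ, Finset.prod_sigma, Finset.prod_sigma]
  congr 1
  exact Finset.prod_comm

lemma segre_ideal (x : MvPolynomial ((_ : Fin n) × Fin (a + 1)) k)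
    (hx : x ∈ smallDiagonalIdeal k n a) : segre k n a x = 0 := by
  have : smallDiagonalIdeal k n a ≤ RingHom.ker (segre k n a) := by
    unfold smallDiagonalIdeal
    rw [Ideal.span_le]
    rintro f ⟨p, q, j, l, rfl⟩
    simp only [SetLike.mem_coe, RingHom.mem_ker, segre, map_sub, map_mul, aeval_X]
    ring
  exact this hx

variable (k n a) in
def segreQ : SD k n a →ₐ[k] MvPolynomial (Fin n ⊕ Fin (a + 1)) k :=
  Ideal.Quotient.liftₐ _ (segre k n a) segre_ideal

lemma segreQ_mon (M : ((_ : Fin n) × Fin (a + 1)) →₀ ℕ) :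
    segreQ k n a (mon k n a M) = monomial (marg (rowSum M) (colSum M)) 1 := by
  rw [← segre_monomial]; rfl

lemma weight_cox (M : ((_ : Fin n) × Fin (a + 1)) →₀ ℕ) :
    Finsupp.weight (coxWeight n (fun _ => a)) M = rowSum M := by
  rw [Finsupp.weight_apply, Finsupp.sum_fintype _ _ (by simp)]
  funext i
  rw [Finset.sum_apply, ← Finset.univ_sigma_univ, Finset.sum_sigma]
  simp only [coxWeight, rowSum, Pi.smul_apply, Pi.single_apply, smul_eq_mul, mul_ite, mul_one,
    mul_zero]
  rw [Finset.sum_eq_single i]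
  · simp
  · intro j _ hj; simp [hj.symm]
  · simp

lemma quotComponent_eq (d : Fin n → ℕ) :
    quotComponent (a := fun _ => a) (smallDiagonalIdeal k n a) d =
      Submodule.span k (mon k n a '' {M | rowSum M = d}) := by
  have h : weightedHomogeneousSubmodule k (coxWeight n (fun _ => a)) d =
      Submodule.span k ((fun M => monomial M (1 : k)) '' {M | rowSum M = d}) := by
    rw [weightedHomogeneousSubmodule_eq_finsupp_supported]
    simp only [weight_cox]
    exact restrictSupport_eq_span (R := k) _
  unfold quotComponent
  rw [h, Submodule.map_span, Set.image_image]
  rfl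

/-- index set -/
def idx (n a : ℕ) (b : Fin n → ℕ) (s : ℕ) : Finset ((_ : Fin n → ℕ) × (Fin (a + 1) → ℕ)) :=
  (Finset.Nat.antidiagonalTuple n s).sigma
    fun t => Finset.Nat.antidiagonalTuple (a + 1) (∑ i, b i * t i)

lemma hilb_eq_card (b : Fin n → ℕ) (hb : ∀ i, 0 < b i) (s : ℕ) :
    hilbTb (a := fun _ => a) (smallDiagonalIdeal k n a) b s = (idx n a b s).card := by
  have hex : ∀ x : idx n a b s, ∃ M : ((_ : Fin n) × Fin (a + 1)) →₀ ℕ,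
      rowSum M = (fun i => b i * x.1.1 i) ∧ colSum M = x.1.2 := by
    rintro ⟨⟨t, β⟩, hx⟩
    simp only [idx, Finset.mem_sigma, Finset.Nat.mem_antidiagonalTuple] at hx
    exact exists_margins _ _ _ rfl hx.2
  choose F hF1 hF2 using hex
  have hli : LinearIndependent k (fun x => mon k n a (F x)) := by
    apply LinearIndependent.of_comp (segreQ k n a).toLinearMap
    have hinj : Function.Injective (fun x : idx n a b s =>
        (marg (fun i => b i * x.1.1 i) x.1.2 : (Fin n ⊕ Fin (a + 1)) →₀ ℕ)) := by
      rintro ⟨⟨t, β⟩, hx⟩ ⟨⟨t', β'⟩, hx'⟩ h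
      have h' := Finsupp.equivFunOnFinite.symm.injective h
      have ht : t = t' := by
        funext i
        have := congrFun h' (Sum.inl i)
        simpa [(hb i).ne'] using this
      have hβ : β = β' := by
        funext i
        exact congrFun h' (Sum.inr i)
      subst ht hβ
      rfl
    have := (basisMonomials (Fin n ⊕ Fin (a + 1)) k).linearIndependent.comp _ hinj
    have heq : (segreQ k n a).toLinearMap ∘ (fun x => mon k n a (F x)) =
        (basisMonomials (Fin n ⊕ Fin (a + 1)) k) ∘ (fun x : idx n a b s =>
          (marg (fun i => b i * x.1.1 i) x.1.2 : (Fin n ⊕ Fin (a + 1)) →₀ ℕ)) := by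
      funext x
      simp [segreQ_mon, hF1, hF2]
    rw [heq]
    exact this
  have hspan : (⨆ t ∈ Finset.Nat.antidiagonalTuple n s,
      quotComponent (a := fun _ => a) (smallDiagonalIdeal k n a) (fun i => b i * t i)) =
      Submodule.span k (Set.range fun x => mon k n a (F x)) := by
    apply le_antisymm
    · refine iSup₂_le fun t ht => ?_
      rw [quotComponent_eq, Submodule.span_le]
      rintro _ ⟨M, hM, rfl⟩
      have hM' : rowSum M = fun i => b i * t i := hM
      have hx : (⟨t, colSum M⟩ : (_ : Fin n → ℕ) × (Fin (a + 1) → ℕ)) ∈ idx n a b s := by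
        simp only [idx, Finset.mem_sigma, Finset.Nat.mem_antidiagonalTuple]
        rw [← sum_rowSum, hM']
        exact ⟨Finset.Nat.mem_antidiagonalTuple.mp ht, rfl⟩
      apply Submodule.subset_span
      refine ⟨⟨_, hx⟩, ?_⟩
      exact mon_eq _ _ _ rfl (by rw [hF1, hM']) (by rw [hF2])
    · rw [Submodule.span_le]
      rintro _ ⟨x, rfl⟩
      have hx := x.2
      simp only [idx, Finset.mem_sigma] at hx
      have hle := le_iSup₂_of_le (f := fun t (_ : t ∈ Finset.Nat.antidiagonalTuple n s) =>
        quotComponent (a := fun _ => a) (smallDiagonalIdeal k n a) (fun i => b i * t i))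
        x.1.1 hx.1 le_rfl
      apply hle
      rw [quotComponent_eq]
      exact Submodule.subset_span ⟨F x, hF1 x, rfl⟩
  unfold hilbTb
  rw [hspan, finrank_span_eq_card hli, Fintype.card_coe]

end algebra

/-- `f` is a polynomial function of degree at most `D` with normalized leading coefficient `c`. -/
def PolyLead (f : ℕ → ℚ) (D : ℕ) (c : ℚ) : Prop :=
  ∃ P : Polynomial ℚ, P.natDegree ≤ D ∧ P.coeff D * (Nat.factorial D) = c ∧
    ∀ s : ℕ, f s = P.eval (s : ℚ)

lemma PolyLead.add {f g : ℕ → ℚ} {D : ℕ} {c e : ℚ} (hf : PolyLead f D c) (hg : PolyLead g D e) :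
    PolyLead (fun s => f s + g s) D (c + e) := by
  obtain ⟨P, h1, h2, h3⟩ := hf
  obtain ⟨Q, k1, k2, k3⟩ := hg
  refine ⟨P + Q, Polynomial.natDegree_add_le_of_degree_le h1 k1, ?_, fun s => ?_⟩
  · rw [Polynomial.coeff_add, add_mul, h2, k2]
  · simp only [h3, k3, Polynomial.eval_add]

lemma PolyLead.smul {f : ℕ → ℚ} {D : ℕ} {c : ℚ} (r : ℚ) (hf : PolyLead f D c) :
    PolyLead (fun s => r * f s) D (r * c) := by
  obtain ⟨P, h1, h2, h3⟩ := hf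
  refine ⟨Polynomial.C r * P, (Polynomial.natDegree_C_mul_le _ _).trans h1, ?_, fun s => ?_⟩
  · rw [Polynomial.coeff_C_mul, mul_assoc, h2]
  · simp only [h3, Polynomial.eval_mul, Polynomial.eval_C]

lemma PolyLead.sum {ι : Type*} (S : Finset ι) (f : ι → ℕ → ℚ) (D : ℕ) (c : ι → ℚ)
    (h : ∀ i ∈ S, PolyLead (f i) D (c i)) :
    PolyLead (fun s => ∑ i ∈ S, f i s) D (∑ i ∈ S, c i) := by
  classical
  induction S using Finset.induction_on with
  | empty => exact ⟨0, by simp, by simp, by simp⟩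
  | insert i S hi ih =>
    have := (h i (by simp)).add (ih fun j hj => h j (by simp [hj]))
    simpa [Finset.sum_insert hi] using this

lemma PolyLead.mono {f : ℕ → ℚ} {D : ℕ} {c : ℚ} (hf : PolyLead f D c) :
    PolyLead f (D + 1) 0 := by
  obtain ⟨P, h1, h2, h3⟩ := hf
  refine ⟨P, by omega, ?_, h3⟩
  rw [Polynomial.coeff_eq_zero_of_natDegree_lt (by omega), zero_mul]

lemma polyLead_choose (b c a : ℕ) (hb : 0 < b) :
    PolyLead (fun s => ((b * s + c).choose a : ℚ)) a ((b : ℚ) ^ a) := by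
  have hb' : (b : ℚ) ≠ 0 := by positivity
  have hfac : (Nat.factorial a : ℚ) ≠ 0 := by positivity
  set Q : Polynomial ℚ := Polynomial.C (b : ℚ) * Polynomial.X + Polynomial.C (c : ℚ) with hQ
  have hQd : Q.natDegree = 1 := Polynomial.natDegree_linear hb'
  have hQl : Q.leadingCoeff = b := Polynomial.leadingCoeff_linear hb'
  have hd : ((descPochhammer ℚ a).comp Q).natDegree = a := by
    rw [Polynomial.natDegree_comp, hQd, descPochhammer_natDegree, mul_one]
  have hl : ((descPochhammer ℚ a).comp Q).coeff a = (b : ℚ) ^ a := by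
    have := Polynomial.leadingCoeff_comp (p := descPochhammer ℚ a) (q := Q) (by omega)
    rw [Polynomial.leadingCoeff, hd, hQl, descPochhammer_natDegree,
      (monic_descPochhammer ℚ a).leadingCoeff, one_mul] at this
    exact this
  refine ⟨Polynomial.C ((Nat.factorial a : ℚ)⁻¹) * (descPochhammer ℚ a).comp Q,
    (Polynomial.natDegree_C_mul_le _ _).trans hd.le, ?_, fun s => ?_⟩
  · rw [Polynomial.coeff_C_mul, hl]; field_simp
  · have : Q.eval (s : ℚ) = ((b * s + c : ℕ) : ℚ) := by simp [hQ]
    rw [Polynomial.eval_mul, Polynomial.eval_C, Polynomial.eval_comp, this,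
      descPochhammer_eval_eq_descFactorial, Nat.descFactorial_eq_factorial_mul_choose]
    push_cast
    field_simp

lemma PolyLead.zero_eq {f : ℕ → ℚ} {c : ℚ} (hf : PolyLead f 0 c) :
    f = fun s => c * (s.choose 0 : ℚ) := by
  obtain ⟨P, h1, h2, h3⟩ := hf
  funext s
  rw [h3, Polynomial.eq_C_of_natDegree_le_zero h1, ← h2]
  simp

lemma PolyLead.succ_eq {f : ℕ → ℚ} {D : ℕ} {c : ℚ} (hf : PolyLead f (D + 1) c) :
    ∃ g c', PolyLead g D c' ∧ f = fun s => c * (s.choose (D + 1) : ℚ) + g s := by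
  have h := hf.add ((polyLead_choose 1 0 (D + 1) one_pos).smul (-c))
  simp only [one_mul, add_zero, Nat.cast_one, one_pow, mul_one, add_neg_cancel] at h
  obtain ⟨P, h1, h2, h3⟩ := h
  refine ⟨fun s => f s + -c * (s.choose (D + 1) : ℚ), _, ⟨P, ?_, rfl, h3⟩, ?_⟩
  · have h0 : P.coeff (D + 1) = 0 := by
      have : ((D + 1).factorial : ℚ) ≠ 0 := by positivity
      simpa [this] using h2
    rw [Polynomial.natDegree_le_iff_coeff_eq_zero] at h1 ⊢
    intro N hN
    rcases eq_or_lt_of_le (Nat.succ_le_of_lt hN) with h | h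
    · rw [← h]; exact h0
    · exact h1 N h
  · funext s; ring

lemma sum_antidiagonal_choose_mul_choose (s k l : ℕ) :
    ∑ p ∈ Finset.HasAntidiagonal.antidiagonal s, p.1.choose k * p.2.choose l = (s + 1).choose (k + l + 1) := by
  induction s generalizing k with
  | zero =>
    cases k <;> cases l <;> simp [Nat.choose_eq_zero_of_lt]
  | succ s ih =>
    rw [Finset.Nat.sum_antidiagonal_succ]
    cases k with
    | zero =>
      have := ih 0
      simp only [Nat.choose_zero_right, one_mul, zero_add] at this ⊢
      rw [this, Nat.choose_succ_succ (s + 1)]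
    | succ k =>
      simp only [Nat.choose_zero_succ, zero_mul, zero_add, Nat.choose_succ_succ _ k, add_mul,
        Finset.sum_add_distrib, ih]
      rw [Nat.choose_succ_succ (s + 1), show k + 1 + l = k + l + 1 by ring]

/-- convolution -/
def cnv (f g : ℕ → ℚ) (s : ℕ) : ℚ := ∑ p ∈ Finset.HasAntidiagonal.antidiagonal s, f p.1 * g p.2

lemma cnv_comm (f g : ℕ → ℚ) : cnv f g = cnv g f := by
  funext s
  unfold cnv
  rw [← Finset.Nat.sum_antidiagonal_swap]
  exact Finset.sum_congr rfl fun _ _ => mul_comm _ _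

lemma cnv_add (f g h : ℕ → ℚ) (c : ℚ) :
    cnv f (fun s => c * g s + h s) = fun s => c * cnv f g s + cnv f h s := by
  funext s
  unfold cnv
  rw [Finset.mul_sum, ← Finset.sum_add_distrib]
  exact Finset.sum_congr rfl fun _ _ => by ring

lemma cnv_mul (f g : ℕ → ℚ) (c : ℚ) :
    cnv f (fun s => c * g s) = fun s => c * cnv f g s := by
  funext s
  unfold cnv
  rw [Finset.mul_sum]
  exact Finset.sum_congr rfl fun _ _ => by ring

/-- if convolution with all binomials is fine, convolution with all polynomials is -/
lemma polyLead_cnv_aux (f : ℕ → ℚ) (D : ℕ) (c : ℚ)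
    (hf : ∀ l, PolyLead (cnv f (fun s => (s.choose l : ℚ))) (D + l + 1) c)
    {g : ℕ → ℚ} {E : ℕ} {e : ℚ} (hg : PolyLead g E e) :
    PolyLead (cnv f g) (D + E + 1) (c * e) := by
  induction E generalizing g e with
  | zero =>
    rw [hg.zero_eq, cnv_mul, mul_comm c]
    exact (hf 0).smul e
  | succ E ih =>
    obtain ⟨g', c', h', rfl⟩ := hg.succ_eq
    rw [cnv_add]
    have := ((hf (E + 1)).smul e).add (ih h').mono
    rw [add_zero, mul_comm e] at this
    exact this

lemma PolyLead.cnv {f g : ℕ → ℚ} {D E : ℕ} {c e : ℚ} (hf : PolyLead f D c)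
    (hg : PolyLead g E e) : PolyLead (cnv f g) (D + E + 1) (c * e) := by
  refine polyLead_cnv_aux f D c (fun l => ?_) hg
  rw [cnv_comm, add_comm D l, ← one_mul c]
  refine polyLead_cnv_aux _ l 1 (fun m => ?_) hf
  have h : _root_.cnv (fun s => (s.choose l : ℚ)) (fun s => (s.choose m : ℚ))
      = fun s => ((1 * s + 1).choose (l + m + 1) : ℚ) := by
    funext s
    rw [one_mul, ← sum_antidiagonal_choose_mul_choose]
    simp [_root_.cnv]
  rw [h]
  simpa using polyLead_choose 1 1 (l + m + 1) one_pos

lemma sum_antidiagonalTuple_succ {M : Type*} [AddCommMonoid M] (n s : ℕ)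
    (f : (Fin (n + 1) → ℕ) → M) :
    ∑ t ∈ Finset.Nat.antidiagonalTuple (n + 1) s, f t =
      ∑ p ∈ Finset.HasAntidiagonal.antidiagonal s, ∑ t ∈ Finset.Nat.antidiagonalTuple n p.2,
        f (Fin.cons p.1 t) := by
  rw [Finset.sum_sigma']
  symm
  refine Finset.sum_bij' (fun x _ => Fin.cons x.1.1 x.2)
    (fun t _ => ⟨(t 0, ∑ i : Fin n, t i.succ), fun i => t i.succ⟩) ?_ ?_ ?_ ?_ ?_
  · rintro ⟨⟨i, j⟩, t⟩ h
    simp only [Finset.mem_sigma, Finset.HasAntidiagonal.mem_antidiagonal, Finset.Nat.mem_antidiagonalTuple] at h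
    simp [Finset.Nat.mem_antidiagonalTuple, Fin.sum_univ_succ, h]
  · intro t h
    simp only [Finset.Nat.mem_antidiagonalTuple, Fin.sum_univ_succ] at h
    simp [Finset.Nat.mem_antidiagonalTuple, h]
  · rintro ⟨⟨i, j⟩, t⟩ h
    simp only [Finset.mem_sigma, Finset.HasAntidiagonal.mem_antidiagonal, Finset.Nat.mem_antidiagonalTuple] at h
    simp [h]
  · intro t h
    exact Fin.cons_self_tail t
  · intros; rfl

lemma polyLead_main (n : ℕ) (a c : ℕ) (b : Fin (n + 1) → ℕ) (hb : ∀ i, 0 < b i) :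
    PolyLead (fun s => ∑ t ∈ Finset.Nat.antidiagonalTuple (n + 1) s,
        ((∑ i, b i * t i + c).choose a : ℚ)) (a + n)
      (∑ α ∈ Finset.Nat.antidiagonalTuple (n + 1) a, ∏ i, (b i : ℚ) ^ (α i)) := by
  induction n generalizing a with
  | zero =>
    have h1 : ∀ s, Finset.Nat.antidiagonalTuple (0 + 1) s = {![s]} :=
      Finset.Nat.antidiagonalTuple_one
    simp only [h1, Finset.sum_singleton]
    simpa using polyLead_choose (b 0) c a (hb 0)
  | succ n ih =>
    have key := PolyLead.sum (Finset.HasAntidiagonal.antidiagonal a)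
      (fun p => cnv (fun s => ((b 0 * s + 0).choose p.1 : ℚ))
        (fun s => ∑ t ∈ Finset.Nat.antidiagonalTuple (n + 1) s,
          ((∑ i : Fin (n + 1), b i.succ * t i + c).choose p.2 : ℚ)))
      (a + (n + 1))
      (fun p => (b 0 : ℚ) ^ p.1 * ∑ α ∈ Finset.Nat.antidiagonalTuple (n + 1) p.2,
        ∏ i : Fin (n + 1), (b i.succ : ℚ) ^ (α i)) (by
        intro p hp
        have h := (polyLead_choose (b 0) 0 p.1 (hb 0)).cnv
          (ih p.2 (fun i => b i.succ) (fun i => hb _))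
        rw [Finset.HasAntidiagonal.mem_antidiagonal] at hp
        rwa [show p.1 + (p.2 + n) + 1 = a + (n + 1) by omega] at h)
    convert key using 1
    · funext s
      rw [sum_antidiagonalTuple_succ]
      unfold cnv
      rw [Finset.sum_comm]
      refine Finset.sum_congr rfl fun q _ => ?_
      simp_rw [Finset.mul_sum]
      rw [Finset.sum_comm]
      refine Finset.sum_congr rfl fun t _ => ?_
      rw [Fin.sum_univ_succ]
      simp only [Fin.cons_zero, Fin.cons_succ]
      rw [add_assoc, Nat.add_choose_eq]
      push_cast
      simp
    · rw [sum_antidiagonalTuple_succ]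
      refine Finset.sum_congr rfl fun q _ => ?_
      rw [Finset.mul_sum]
      refine Finset.sum_congr rfl fun t _ => ?_
      rw [Fin.prod_univ_succ]
      simp

lemma card_antidiagonalTuple_succ (m N : ℕ) :
    (Finset.Nat.antidiagonalTuple (m + 1) N).card = (N + m).choose m := by
  induction m generalizing N with
  | zero => simp
  | succ m ih =>
    have h := sum_antidiagonalTuple_succ (m + 1) N (fun _ => (1 : ℕ))
    rw [← Finset.card_eq_sum_ones] at h
    simp only [← Finset.card_eq_sum_ones, ih] at h
    rw [h, Finset.Nat.sum_antidiagonal_eq_sum_range_succ (fun _ j => (j + m).choose m),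
      Nat.succ_eq_add_one]
    have h2 := Finset.sum_range_reflect (fun j => (j + m).choose m) (N + 1)
    rw [Nat.sum_range_add_choose, Nat.add_sub_cancel] at h2
    rw [h2]
    rfl

theorem degree_dim_scroll_of_small_diagonal {k : Type} [Field k] {n : ℕ}
    (hn : 0 < n) (a : ℕ) (b : Fin n → ℕ) (hb : ∀ i, 0 < b i) :
    HasDegreeDim (hilbTb (a := fun _ => a) (smallDiagonalIdeal k n a) b)
      (a + n - 1)
      (∑ α ∈ Finset.Nat.antidiagonalTuple n a, ∏ i, (b i : ℚ) ^ (α i)) := by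
  obtain ⟨n, rfl⟩ : ∃ m, n = m + 1 := ⟨n - 1, by omega⟩
  obtain ⟨P, h1, h2, h3⟩ := polyLead_main n a a b hb
  have hpos : 0 < ∑ α ∈ Finset.Nat.antidiagonalTuple (n + 1) a, ∏ i, (b i : ℚ) ^ (α i) := by
    apply Finset.sum_pos
    · intro α _
      exact Finset.prod_pos fun i _ => pow_pos (by exact_mod_cast hb i) _
    · rw [← Finset.card_pos, card_antidiagonalTuple_succ]
      exact Nat.choose_pos (by omega)
  have hne : P.coeff (a + n) ≠ 0 := by
    intro h
    rw [h, zero_mul] at h2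
    exact hpos.ne h2
  have hdeg : P.natDegree = a + n :=
    le_antisymm h1 (Polynomial.le_natDegree_of_ne_zero hne)
  refine ⟨P, ⟨0, fun s _ => ?_⟩, hdeg, ?_⟩
  · rw [← h3, hilb_eq_card b hb, idx, Finset.card_sigma]
    simp only [card_antidiagonalTuple_succ]
    push_cast
    rfl
  · rw [Polynomial.leadingCoeff, hdeg]
    exact h2

end
end

section
/- Let I = (x_{1,0}^m, x_{1,1}, x_{2,0}) ⊆ k[x_{1,0},x_{1,1},x_{2,0},x_{2,1}] with the Z^2-grading deg(x_{i,j}) = e_i, and b = (b_1, b_2) ∈ ℕ_+^2. Then the kernel of the map S = k[z_{1,α}, z_{2,β}] → A/I (z_{i,α} ↦ x_i^α, |α| = b_i) is the ideal generated by {z_{1,α} : α ≠ (b_1,0)}, z_{1,(b_1,0)}^{⌈m/b_1⌉}, and {z_{2,β} : β ≠ (0,b_2)}. In particular C(Z;b) is a non-reduced point of degree ⌈m/b_1⌉. -/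
/-!
STATEMENT 15: for `I = (x₁₀^m, x₁₁, x₂₀)` the kernel of
`S = k[z_{1,α}, z_{2,β}] → A/I` is generated by the `z_{1,α}`, `α ≠ (b₁,0)`,
the power `z_{1,(b₁,0)}^{⌈m/b₁⌉}`, and the `z_{2,β}`, `β ≠ (0,b₂)`;
in particular `C(Z;b)` is a non-reduced point of degree `⌈m/b₁⌉`.

The monomial `x_{i,0}^{bᵢ-j} x_{i,1}^{j}` of degree `bᵢ` is indexed by
`j ∈ Fin (bᵢ+1)`, the exponent of `x_{i,1}`; so `α = (b₁,0)` corresponds to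
`j = 0` and `β = (0,b₂)` to `j = Fin.last b₂`.
-/

open MvPolynomial

noncomputable section

/-- The variable `x_{i,j}` of the Cox ring of `ℙ¹ × ℙ¹`. -/
def xv (k : Type) [Field k] (i : Fin 2) (j : Fin 2) :
    MvPolynomial ((i : Fin 2) × Fin (1 + 1)) k := X ⟨i, j⟩

abbrev Sg : Type := (i : Fin 2) × Fin (1 + 1)

def expE (p q : ℕ) : Sg →₀ ℕ := Finsupp.single ⟨0, 0⟩ p + Finsupp.single ⟨1, 1⟩ q

lemma mem_I_iff {k : Type} [Field k] (m : ℕ) (f : MvPolynomial Sg k) :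
    f ∈ Ideal.span {xv k 0 0 ^ m, xv k 0 1, xv k 1 0} ↔
      ∀ D ∈ f.support, m ≤ D ⟨0, 0⟩ ∨ 1 ≤ D ⟨0, 1⟩ ∨ 1 ≤ D ⟨1, 0⟩ := by
  have h : ({xv k 0 0 ^ m, xv k 0 1, xv k 1 0} : Set (MvPolynomial Sg k)) =
      (fun s => monomial s (1 : k)) ''
        {Finsupp.single ⟨0, 0⟩ m, Finsupp.single ⟨0, 1⟩ 1, Finsupp.single ⟨1, 0⟩ 1} := by
    simp only [Set.image_insert_eq, Set.image_singleton, xv, X_pow_eq_monomial]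
    rfl
  rw [h, mem_ideal_span_monomial_image]
  simp [Finsupp.single_le_iff]

lemma lt_ceil_iff (m c u : ℕ) (hc : 0 < c) : u < (m + c - 1) / c ↔ c * u < m := by
  rw [Nat.lt_iff_add_one_le, Nat.le_div_iff_mul_le hc]
  have : (u + 1) * c = c * u + c := by ring
  omega

lemma monE_not_mem {k : Type} [Field k] (m p q : ℕ) (hp : p < m) (f : MvPolynomial Sg k)
    (hf : f ∈ Ideal.span {xv k 0 0 ^ m, xv k 0 1, xv k 1 0}) : coeff (expE p q) f = 0 := by
  by_contra h
  have := (mem_I_iff m f).1 hf _ (mem_support_iff.2 h)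
  simp [expE] at this
  omega

def expL (b : Fin 2 → ℕ) : Fin (b 0 + 1) ⊕ Fin (b 1 + 1) → (Sg →₀ ℕ) :=
  Sum.elim
    (fun j => Finsupp.single ⟨0, 0⟩ (b 0 - (j : ℕ)) + Finsupp.single ⟨0, 1⟩ (j : ℕ))
    (fun j => Finsupp.single ⟨1, 0⟩ (b 1 - (j : ℕ)) + Finsupp.single ⟨1, 1⟩ (j : ℕ))

def totL (b : Fin 2 → ℕ) (d : Fin (b 0 + 1) ⊕ Fin (b 1 + 1) →₀ ℕ) : Sg →₀ ℕ :=
  ∑ p, d p • expL b p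

lemma aeval_mon {k : Type} [Field k] (b : Fin 2 → ℕ)
    (d : Fin (b 0 + 1) ⊕ Fin (b 1 + 1) →₀ ℕ) (a : k) :
    aeval (R := k) (fun p => monomial (expL b p) (1 : k)) (monomial d a) =
      monomial (totL b d) a := by
  rw [aeval_monomial, Finsupp.prod_fintype _ _ (by simp)]
  simp only [monomial_pow, one_pow, totL]
  rw [monomial_sum_index, ← mul_one a]
  simp [algebraMap_eq]

lemma totL_eq (b : Fin 2 → ℕ) (hb : ∀ i, 0 < b i) (d : Fin (b 0 + 1) ⊕ Fin (b 1 + 1) →₀ ℕ)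
    (u v : ℕ) : totL b d = expE (b 0 * u) (b 1 * v) ↔
      d = Finsupp.single (Sum.inl 0) u + Finsupp.single (Sum.inr (Fin.last (b 1))) v := by
  constructor
  · intro h
    have h01 := DFunLike.congr_fun h ⟨0, 1⟩
    have h10 := DFunLike.congr_fun h ⟨1, 0⟩
    have h00 := DFunLike.congr_fun h ⟨0, 0⟩
    have h11 := DFunLike.congr_fun h ⟨1, 1⟩
    simp [totL, expE, expL, Finsupp.finsetSum_apply] at h01 h10 h00 h11
    have hl : ∀ j : Fin (b 0 + 1), j ≠ 0 → d (Sum.inl j) = 0 := by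
      intro j hj
      rcases h01 j with h | h
      · exact h
      · exact absurd h hj
    have hr : ∀ j : Fin (b 1 + 1), j ≠ Fin.last (b 1) → d (Sum.inr j) = 0 := by
      intro j hj
      rcases h10 j with h | h
      · exact h
      · exact absurd (Fin.ext (by have := j.2; simp; omega)) hj
    rw [Finset.sum_eq_single 0 (by intro j _ hj; simp [hl j hj]) (by simp)] at h00
    rw [Finset.sum_eq_single (Fin.last (b 1)) (by intro j _ hj; simp [hr j hj]) (by simp)] at h11
    have hu : d (Sum.inl 0) = u := by
      have := hb 0
      simp at h00
      exact Nat.eq_of_mul_eq_mul_left this (by linarith)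
    have hv : d (Sum.inr (Fin.last (b 1))) = v := by
      have := hb 1
      simp at h11
      exact Nat.eq_of_mul_eq_mul_left this (by linarith)
    ext p
    rcases p with j | j
    · by_cases hj : j = 0
      · subst hj; simp [hu]
      · simp [hl j hj, Finsupp.single_apply, Ne.symm hj]
    · by_cases hj : j = Fin.last (b 1)
      · subst hj; simp [hv]
      · simp [hr j hj, Finsupp.single_apply, Ne.symm hj]
  · rintro rfl
    simp only [totL, Finsupp.add_apply, add_smul, Finset.sum_add_distrib]
    rw [Finset.sum_eq_single (Sum.inl 0) (by intro j _ hj; simp [Finsupp.single_apply, Ne.symm hj])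
      (by simp), Finset.sum_eq_single (Sum.inr (Fin.last (b 1)))
      (by intro j _ hj; simp [Finsupp.single_apply, Ne.symm hj]) (by simp)]
    simp [expL, expE, mul_comm]

lemma coeff_aeval {k : Type} [Field k] (b : Fin 2 → ℕ) (hb : ∀ i, 0 < b i) (u v : ℕ)
    (f : MvPolynomial (Fin (b 0 + 1) ⊕ Fin (b 1 + 1)) k) :
    coeff (expE (b 0 * u) (b 1 * v))
      (aeval (R := k) (fun p => monomial (expL b p) (1 : k)) f) =
    coeff (Finsupp.single (Sum.inl 0) u + Finsupp.single (Sum.inr (Fin.last (b 1))) v) f := by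
  induction f using MvPolynomial.induction_on' with
  | monomial d a =>
    rw [aeval_mon, coeff_monomial, coeff_monomial]
    simp only [totL_eq b hb]
  | add p q hp hq => simp only [map_add, coeff_add, hp, hq]

lemma mem_J_iff {k : Type} [Field k] (b : Fin 2 → ℕ) (c : ℕ)
    (f : MvPolynomial (Fin (b 0 + 1) ⊕ Fin (b 1 + 1)) k) :
    f ∈ Ideal.span ({ f | ∃ j : Fin (b 0 + 1), j ≠ 0 ∧ f = X (Sum.inl j) } ∪
        { X (Sum.inl 0) ^ c } ∪
        { f | ∃ j : Fin (b 1 + 1), j ≠ Fin.last (b 1) ∧ f = X (Sum.inr j) }) ↔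
      ∀ d ∈ f.support, (∃ j : Fin (b 0 + 1), j ≠ 0 ∧ d (Sum.inl j) ≠ 0) ∨ c ≤ d (Sum.inl 0) ∨
        (∃ j : Fin (b 1 + 1), j ≠ Fin.last (b 1) ∧ d (Sum.inr j) ≠ 0) := by
  have h : ({ f | ∃ j : Fin (b 0 + 1), j ≠ 0 ∧ f = X (Sum.inl j) } ∪
        { X (Sum.inl 0) ^ c } ∪
        { f | ∃ j : Fin (b 1 + 1), j ≠ Fin.last (b 1) ∧ f = X (Sum.inr j) } :
          Set (MvPolynomial (Fin (b 0 + 1) ⊕ Fin (b 1 + 1)) k)) =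
      (fun s => monomial s (1 : k)) ''
        ({ s | ∃ j : Fin (b 0 + 1), j ≠ 0 ∧ s = Finsupp.single (Sum.inl j) 1 } ∪
        { Finsupp.single (Sum.inl 0) c } ∪
        { s | ∃ j : Fin (b 1 + 1), j ≠ Fin.last (b 1) ∧ s = Finsupp.single (Sum.inr j) 1 }) := by
    rw [Set.image_union, Set.image_union, Set.image_singleton, X_pow_eq_monomial]
    congr 1
    · congr 1
      ext f
      constructor
      · rintro ⟨j, hj, rfl⟩; exact ⟨_, ⟨j, hj, rfl⟩, rfl⟩
      · rintro ⟨_, ⟨j, hj, rfl⟩, rfl⟩; exact ⟨j, hj, rfl⟩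
    · ext f
      constructor
      · rintro ⟨j, hj, rfl⟩; exact ⟨_, ⟨j, hj, rfl⟩, rfl⟩
      · rintro ⟨_, ⟨j, hj, rfl⟩, rfl⟩; exact ⟨j, hj, rfl⟩
  rw [h, mem_ideal_span_monomial_image]
  refine forall₂_congr fun d _ => ?_
  constructor
  · rintro ⟨s, ((⟨j, hj, rfl⟩ | rfl) | ⟨j, hj, rfl⟩), hs⟩
    · rw [Finsupp.single_le_iff] at hs
      exact Or.inl ⟨j, hj, by omega⟩
    · rw [Finsupp.single_le_iff] at hs
      exact Or.inr (Or.inl hs)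
    · rw [Finsupp.single_le_iff] at hs
      exact Or.inr (Or.inr ⟨j, hj, by omega⟩)
  · rintro (⟨j, hj, h⟩ | h | ⟨j, hj, h⟩)
    · exact ⟨_, Or.inl (Or.inl ⟨j, hj, rfl⟩), Finsupp.single_le_iff.2 (by omega)⟩
    · exact ⟨_, Or.inl (Or.inr rfl), Finsupp.single_le_iff.2 h⟩
    · exact ⟨_, Or.inr ⟨j, hj, rfl⟩, Finsupp.single_le_iff.2 (by omega)⟩

lemma expL_eq (k : Type) [Field k] (b : Fin 2 → ℕ) (p : Fin (b 0 + 1) ⊕ Fin (b 1 + 1)) :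
    monomial (expL b p) (1 : k) = Sum.elim
      (fun j : Fin (b 0 + 1) => (xv k 0 0 ^ (b 0 - (j : ℕ)) * xv k 0 1 ^ (j : ℕ)))
      (fun j : Fin (b 1 + 1) => (xv k 1 0 ^ (b 1 - (j : ℕ)) * xv k 1 1 ^ (j : ℕ))) p := by
  rcases p with j | j <;> simp [expL, xv, X_pow_eq_monomial, monomial_mul]

lemma weight_cox_s15 (D : Sg →₀ ℕ) :
    Finsupp.weight (coxWeight 2 (fun _ => 1)) D =
      ![D ⟨0, 0⟩ + D ⟨0, 1⟩, D ⟨1, 0⟩ + D ⟨1, 1⟩] := by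
  rw [Finsupp.weight_apply, Finsupp.sum_fintype _ _ (by simp)]
  rw [Fintype.sum_sigma]
  ext i
  fin_cases i <;> simp [coxWeight, Fin.sum_univ_two]

lemma hilb_eq_s15 {k : Type} [Field k] (m : ℕ)
    (b : Fin 2 → ℕ) (hb : ∀ i, 0 < b i)
    (I : Ideal (MvPolynomial ((i : Fin 2) × Fin (1 + 1)) k))
    (hI : I = Ideal.span {xv k 0 0 ^ m, xv k 0 1, xv k 1 0})
    (s : ℕ) (hs : (m + b 0 - 1) / b 0 ≤ s) :
    hilbTb I b s = (m + b 0 - 1) / b 0 := by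
  set c := (m + b 0 - 1) / b 0 with hc
  let e : Fin c → MvPolynomial Sg k ⧸ I := fun u =>
    Ideal.Quotient.mkₐ k I (monomial (expE (b 0 * u) (b 1 * (s - u))) 1)
  have hlt : ∀ u, u < c ↔ b 0 * u < m := fun u => lt_ceil_iff m (b 0) u (hb 0)
  have hli : LinearIndependent k e := by
    rw [Fintype.linearIndependent_iff]
    intro g hg i
    have h1 : Ideal.Quotient.mkₐ k I
        (∑ u : Fin c, g u • monomial (expE (b 0 * u) (b 1 * (s - u))) (1 : k)) = 0 := by
      rw [map_sum, ← hg]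
      simp only [map_smul, e]
    rw [Ideal.Quotient.mkₐ_eq_mk, Ideal.Quotient.eq_zero_iff_mem, hI] at h1
    have h2 := monE_not_mem m (b 0 * i) (b 1 * (s - i)) ((hlt i).1 i.2) _ h1
    rw [coeff_sum, Finset.sum_eq_single i] at h2
    · simpa using h2
    · intro j _ hj
      rw [coeff_smul, coeff_monomial, if_neg, smul_zero]
      intro h
      have := DFunLike.congr_fun h ⟨0, 0⟩
      simp [expE] at this
      rcases this with h | h
      · exact hj (Fin.ext h)
      · have := hb 0
        omega
    · simp
  have hW : (⨆ t ∈ Finset.Nat.antidiagonalTuple 2 s,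
      quotComponent (a := fun _ => 1) I (fun i => b i * t i)) =
      Submodule.span k (Set.range e) := by
    apply le_antisymm
    · refine iSup₂_le fun t ht => ?_
      rw [Finset.Nat.mem_antidiagonalTuple, Fin.sum_univ_two] at ht
      rintro _ ⟨f, hf, rfl⟩
      have hf' : IsWeightedHomogeneous (coxWeight 2 (fun _ => 1)) f (fun i => b i * t i) := hf
      rw [f.as_sum, map_sum]
      refine Submodule.sum_mem _ fun D hD => ?_
      have hw := hf' (mem_support_iff.1 hD)
      rw [weight_cox_s15] at hw
      have hw0 := congr_fun hw 0
      have hw1 := congr_fun hw 1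
      simp at hw0 hw1
      by_cases hDI : m ≤ D ⟨0, 0⟩ ∨ 1 ≤ D ⟨0, 1⟩ ∨ 1 ≤ D ⟨1, 0⟩
      · have : monomial D (coeff D f) ∈ I := by
          rw [hI, mem_I_iff]
          intro D' hD'
          have := support_monomial_subset hD'
          rw [Finset.mem_singleton] at this
          rwa [this]
        have h0 : (Ideal.Quotient.mkₐ k I).toLinearMap (monomial D (coeff D f)) = 0 :=
          Ideal.Quotient.eq_zero_iff_mem.2 this
        rw [h0]
        exact Submodule.zero_mem _
      · push Not at hDI
        obtain ⟨a1, a2, a3⟩ := hDI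
        have ht0 : t 0 < c := (hlt _).2 (by omega)
        have hDE : D = expE (b 0 * t 0) (b 1 * (s - t 0)) := by
          have : s - t 0 = t 1 := by omega
          rw [this]
          ext ⟨i, j⟩
          fin_cases i <;> fin_cases j <;> simp [expE] <;> omega
        have : (Ideal.Quotient.mkₐ k I).toLinearMap (monomial D (coeff D f)) =
            coeff D f • e ⟨t 0, ht0⟩ := by
          simp only [e]
          rw [← hDE, ← map_smul, smul_monomial, smul_eq_mul, mul_one]
          rfl
        rw [this]
        exact Submodule.smul_mem _ _ (Submodule.subset_span ⟨_, rfl⟩)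
    · rw [Submodule.span_le]
      rintro _ ⟨u, rfl⟩
      have hu := u.2
      have ht : ![(u : ℕ), s - u] ∈ Finset.Nat.antidiagonalTuple 2 s := by
        rw [Finset.Nat.mem_antidiagonalTuple, Fin.sum_univ_two]
        simp
        omega
      refine Submodule.mem_iSup_of_mem ![(u : ℕ), s - u] (Submodule.mem_iSup_of_mem ht ?_)
      refine ⟨monomial (expE (b 0 * u) (b 1 * (s - u))) 1, ?_, rfl⟩
      apply isWeightedHomogeneous_monomial
      rw [weight_cox_s15]
      ext i
      fin_cases i <;> simp [expE]
  unfold hilbTb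
  have := finrank_span_eq_card hli
  rw [Fintype.card_fin] at this
  rw [← this]
  exact congrArg (fun W : Submodule k (MvPolynomial Sg k ⧸ I) => Module.finrank k W) hW

theorem kernel_of_nonreduced_point {k : Type} [Field k] (m : ℕ)
    (b : Fin 2 → ℕ) (hb : ∀ i, 0 < b i)
    (I : Ideal (MvPolynomial ((i : Fin 2) × Fin (1 + 1)) k))
    (hI : I = Ideal.span {xv k 0 0 ^ m, xv k 0 1, xv k 1 0}) :
    (RingHom.ker (MvPolynomial.aeval
        (R := k) (fun p : Fin (b 0 + 1) ⊕ Fin (b 1 + 1) =>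
          match p with
          | Sum.inl j => Ideal.Quotient.mk I
              (xv k 0 0 ^ (b 0 - (j : ℕ)) * xv k 0 1 ^ (j : ℕ))
          | Sum.inr j => Ideal.Quotient.mk I
              (xv k 1 0 ^ (b 1 - (j : ℕ)) * xv k 1 1 ^ (j : ℕ)))).toRingHom =
      Ideal.span ({ f | ∃ j : Fin (b 0 + 1), j ≠ 0 ∧ f = X (Sum.inl j) } ∪
        { X (Sum.inl 0) ^ ((m + b 0 - 1) / b 0) } ∪
        { f | ∃ j : Fin (b 1 + 1), j ≠ Fin.last (b 1) ∧ f = X (Sum.inr j) })) ∧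
    (∃ s₀ : ℕ, ∀ s ≥ s₀, hilbTb I b s = (m + b 0 - 1) / b 0) := by
  refine ⟨?_, (m + b 0 - 1) / b 0, fun s hs => hilb_eq_s15 m b hb I hI s hs⟩
  ext f
  have hF : ∀ f, aeval (R := k) (fun p : Fin (b 0 + 1) ⊕ Fin (b 1 + 1) =>
          match p with
          | Sum.inl j => Ideal.Quotient.mk I
              (xv k 0 0 ^ (b 0 - (j : ℕ)) * xv k 0 1 ^ (j : ℕ))
          | Sum.inr j => Ideal.Quotient.mk I
              (xv k 1 0 ^ (b 1 - (j : ℕ)) * xv k 1 1 ^ (j : ℕ))) f =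
      Ideal.Quotient.mkₐ k I (aeval (R := k) (fun p => monomial (expL b p) (1 : k)) f) := by
    intro f
    rw [← AlgHom.comp_apply]
    congr 1
    apply MvPolynomial.algHom_ext
    intro p
    rw [AlgHom.comp_apply, aeval_X, aeval_X, expL_eq]
    rcases p with j | j <;> rfl
  have hker : ∀ f, f ∈ RingHom.ker (aeval (R := k) (fun p : Fin (b 0 + 1) ⊕ Fin (b 1 + 1) =>
          match p with
          | Sum.inl j => Ideal.Quotient.mk I
              (xv k 0 0 ^ (b 0 - (j : ℕ)) * xv k 0 1 ^ (j : ℕ))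
          | Sum.inr j => Ideal.Quotient.mk I
              (xv k 1 0 ^ (b 1 - (j : ℕ)) * xv k 1 1 ^ (j : ℕ)))).toRingHom ↔
      aeval (R := k) (fun p => monomial (expL b p) (1 : k)) f ∈ I := by
    intro f
    rw [RingHom.mem_ker, ← Ideal.Quotient.eq_zero_iff_mem]
    exact Eq.congr_left (hF f)
  refine (hker f).trans ?_
  rw [mem_J_iff]
  constructor
  · intro hf d hd
    by_contra hcon
    push Not at hcon
    obtain ⟨h1, h2, h3⟩ := hcon
    have hd' : d = Finsupp.single (Sum.inl 0) (d (Sum.inl 0)) +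
        Finsupp.single (Sum.inr (Fin.last (b 1))) (d (Sum.inr (Fin.last (b 1)))) := by
      ext p
      rcases p with j | j
      · by_cases hj : j = 0
        · subst hj; simp
        · simp [h1 j hj, Finsupp.single_apply, Ne.symm hj]
      · by_cases hj : j = Fin.last (b 1)
        · subst hj; simp
        · simp [h3 j hj, Finsupp.single_apply, Ne.symm hj]
    rw [hI] at hf
    have h4 := monE_not_mem m (b 0 * d (Sum.inl 0)) (b 1 * d (Sum.inr (Fin.last (b 1))))
      ((lt_ceil_iff m (b 0) _ (hb 0)).1 h2) _ hf
    rw [coeff_aeval b hb, ← hd'] at h4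
    exact mem_support_iff.1 hd h4
  · intro h
    rw [f.as_sum, map_sum]
    refine Ideal.sum_mem _ fun d hd => ?_
    rw [aeval_mon, hI, mem_I_iff]
    intro D hD
    have hD' := support_monomial_subset hD
    rw [Finset.mem_singleton] at hD'
    subst hD'
    have hle : ∀ p x, d p * expL b p x ≤ totL b d x := by
      intro p x
      simp only [totL, Finsupp.finsetSum_apply, Finsupp.smul_apply, smul_eq_mul]
      exact Finset.single_le_sum (f := fun p => d p * expL b p x)
        (fun _ _ => Nat.zero_le _) (Finset.mem_univ p)
    rcases h d hd with ⟨j, hj, hdj⟩ | hc | ⟨j, hj, hdj⟩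
    · refine Or.inr (Or.inl (le_trans ?_ (hle (Sum.inl j) ⟨0, 1⟩)))
      have : (j : ℕ) ≠ 0 := fun h => hj (Fin.ext h)
      simp only [expL]
      simp
      exact Nat.mul_pos (Nat.pos_of_ne_zero hdj) (Nat.pos_of_ne_zero this)
    · refine Or.inl (le_trans ?_ (hle (Sum.inl 0) ⟨0, 0⟩))
      have h5 := (lt_ceil_iff m (b 0) (d (Sum.inl 0)) (hb 0)).not.1 (by omega)
      simp [expL]
      rw [mul_comm]
      omega
    · refine Or.inr (Or.inr (le_trans ?_ (hle (Sum.inr j) ⟨1, 0⟩)))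
      have : (j : ℕ) ≠ b 1 := fun h => hj (Fin.ext h)
      have := j.2
      simp only [expL]
      simp
      exact Nat.mul_pos (Nat.pos_of_ne_zero hdj) (by omega)

end
end
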